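/- (Flat-model propagation of analyticity along a complex curve in a Levi-flat hypersurface.) Suppose for every t ∈ ℝ the function z₁ ↦ F(z₁, i·t) is entire (complex-differentiable on all of ℂ), and suppose there exist an open neighborhood V of (0, 0) in ℂ² and a function G complex-differentiable on V with G(z₁, z₂) = F(z₁, z₂) for all (z₁, z₂) ∈ M₀ ∩ V. Then F extends holomorphically to a neighborhood of the complex curve S = ℂ × {0}: there exist an open set U ⊆ ℂ² with S ⊆ U and a function H complex-differentiable on U such that H = F on M₀ ∩ U. -/

import Mathlib

theorem exists_separated_points {h : ℝ} (hh : 0 < h) (n : ℕ) {E : Set ℝ} (hE : IsCompact E)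
    (hv : ENNReal.ofReal (n * h) < MeasureTheory.volume E) :
    ∃ t : ℕ → ℝ, (∀ i ≤ n, t i ∈ E) ∧ ∀ i j, i ≤ j → j ≤ n → ((j : ℝ) - i) * h ≤ t j - t i := by
  induction n generalizing E with
  | zero =>
    obtain ⟨x, hx⟩ : E.Nonempty := by
      rw [Set.nonempty_iff_ne_empty]; rintro rfl; simp at hv
    refine ⟨fun _ => x, fun _ _ => hx, fun i j hij hj => ?_⟩
    obtain rfl : j = 0 := by omega
    obtain rfl : i = 0 := by omega
    simp
  | succ n ih =>
    have hne : E.Nonempty := by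
      rw [Set.nonempty_iff_ne_empty]; rintro rfl; simp at hv
    have hmem := hE.sInf_mem hne
    set a := sInf E
    have hsub : E ⊆ Set.Icc a (a + h) ∪ (E ∩ Set.Ici (a + h)) := by
      intro x hx
      have := csInf_le hE.bddBelow hx
      rcases le_total x (a + h) with h1 | h1
      · exact Or.inl ⟨this, h1⟩
      · exact Or.inr ⟨hx, h1⟩
    have hv' : ENNReal.ofReal (n * h) < MeasureTheory.volume (E ∩ Set.Ici (a + h)) := by
      by_contra! hcon
      refine absurd hv (not_lt.2 ?_)
      calc MeasureTheory.volume E ≤ _ := MeasureTheory.measure_mono hsub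
        _ ≤ _ := MeasureTheory.measure_union_le _ _
        _ ≤ ENNReal.ofReal h + ENNReal.ofReal (n * h) := by
          gcongr
          simp
        _ = _ := by
          rw [← ENNReal.ofReal_add hh.le (by positivity)]
          congr 1; push_cast; ring
    obtain ⟨t, ht, hs⟩ := ih (hE.inter_right isClosed_Ici) hv'
    refine ⟨fun i => Nat.casesOn i a t, ?_, ?_⟩
    · rintro (_ | i) hi
      · exact hmem
      · exact (ht i (by omega)).1
    · rintro (_ | i) (_ | j) hij hj
      · simp
      · have h1 := hs 0 j (by omega) (by omega)
        have h2 : a + h ≤ t 0 := (ht 0 (by omega)).2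
        have h3 : ((j : ℝ) + 1) * h ≤ t j - a := by
          push_cast at h1
          linarith
        simpa using h3
      · omega
      · have h1 := hs i j (by omega) (by omega)
        push_cast
        linarith

theorem prod_erase_abs_sub (n j : ℕ) (hj : j ≤ n) :
    ∏ i ∈ (Finset.range (n + 1)).erase j, |(j : ℝ) - i| = (j.factorial : ℝ) * (n - j).factorial := by
  obtain ⟨m, rfl⟩ := Nat.exists_eq_add_of_le hj
  have h1 : ∏ i ∈ (Finset.range (j + m + 1)).erase j, |(j : ℝ) - i|
      = ∏ i ∈ Finset.range (j + (m + 1)), if i = j then 1 else |(j : ℝ) - i| := by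
    rw [← add_assoc, ← Finset.mul_prod_erase _ _ (Finset.mem_range.2 (by omega : j < j + m + 1))]
    rw [if_pos rfl, one_mul]
    refine Finset.prod_congr rfl fun i hi => ?_
    rw [if_neg (Finset.ne_of_mem_erase hi)]
  rw [h1, Finset.prod_range_add, Finset.prod_range_succ', add_tsub_cancel_left,
    ← Finset.prod_range_add_one_eq_factorial, ← Finset.prod_range_add_one_eq_factorial,
    ← Finset.prod_range_reflect (fun i => i + 1) j]
  push_cast
  congr 1
  · refine Finset.prod_congr rfl fun i hi => ?_
    have := Finset.mem_range.1 hi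
    rw [if_neg (by omega), abs_of_pos (by simpa using this)]
    rw [Nat.cast_sub (by omega), Nat.cast_sub (by omega)]
    push_cast
    ring
  · simp only [add_zero, if_true, mul_one]
    refine Finset.prod_congr rfl fun i hi => ?_
    rw [if_neg (by omega)]
    rw [abs_of_neg] <;> linarith [(Nat.cast_nonneg i : (0:ℝ) ≤ i)]

theorem norm_eval_le_of_norm_eval_le_on {s δ : ℝ} (hs : 0 < s) {E : Set ℝ} (hE : IsCompact E)
    (hEs : E ⊆ Set.Icc (-s) s) (hv : ENNReal.ofReal s ≤ MeasureTheory.volume E) {n : ℕ}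
    {p : Polynomial ℂ} (hp : p.degree < (n + 1 : ℕ)) (hδ : ∀ t ∈ E, ‖p.eval (Complex.I * t)‖ ≤ δ)
    {w : ℂ} (hw : ‖w‖ ≤ s) : ‖p.eval w‖ ≤ 12 ^ (n + 1) * δ := by
  have hn : (0 : ℝ) < n + 1 := by positivity
  have hh : 0 < s / (n + 1) := by positivity
  obtain ⟨t, htE, hsep⟩ := exists_separated_points hh n hE (lt_of_lt_of_le
    ((ENNReal.ofReal_lt_ofReal_iff hs).2 (by
      rw [← mul_div_assoc, div_lt_iff₀ hn]; nlinarith)) hv)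
  have hdist : ∀ i j, i ≤ n → j ≤ n → |(j : ℝ) - i| * (s / (n + 1)) ≤ |t j - t i| := by
    intro i j hi hj
    rcases le_total i j with hij | hij
    · rw [abs_of_nonneg (by simpa using hij)]
      exact (hsep i j hij hj).trans (le_abs_self _)
    · rw [abs_sub_comm, abs_sub_comm (t j), abs_of_nonneg (by simpa using hij)]
      exact (hsep j i hij hi).trans (le_abs_self _)
  set v : ℕ → ℂ := fun i => Complex.I * t i with hvdef
  have hvsub : ∀ i j, ‖v j - v i‖ = |t j - t i| := by
    intro i j
    rw [hvdef]
    simp only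
    rw [← mul_sub, norm_mul, Complex.norm_I, one_mul, ← Complex.ofReal_sub, Complex.norm_real,
      Real.norm_eq_abs]
  have hinj : Set.InjOn v (Finset.range (n + 1) : Finset ℕ) := by
    intro i hi j hj hij
    have hi' : i ≤ n := Nat.lt_succ_iff.1 (Finset.mem_range.1 hi)
    have hj' : j ≤ n := Nat.lt_succ_iff.1 (Finset.mem_range.1 hj)
    have h1 := hdist i j hi' hj'
    rw [← hvsub, hij, sub_self, norm_zero] at h1
    have h2 : |(j : ℝ) - i| = 0 := le_antisymm (nonpos_of_mul_nonpos_left h1 hh) (abs_nonneg _)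
    have h3 := sub_eq_zero.1 (abs_eq_zero.1 h2)
    exact_mod_cast h3.symm
  have hbasis : ∀ j ≤ n, ‖(Lagrange.basis (Finset.range (n + 1)) v j).eval w‖
      ≤ (2 ^ n * (n + 1) ^ n / n.factorial) * (n.choose j : ℝ) := by
    intro j hj
    rw [Lagrange.basis, Polynomial.eval_prod, norm_prod]
    have hcard : ((Finset.range (n + 1)).erase j).card = n := by
      rw [Finset.card_erase_of_mem (Finset.mem_range.2 (by omega)), Finset.card_range]; simp
    calc ∏ i ∈ (Finset.range (n + 1)).erase j,
          ‖(Lagrange.basisDivisor (v j) (v i)).eval w‖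
        ≤ ∏ i ∈ (Finset.range (n + 1)).erase j, (2 * (n + 1) * |(j : ℝ) - i|⁻¹) := by
          refine Finset.prod_le_prod (fun _ _ => norm_nonneg _) fun i hi => ?_
          have hij := Finset.ne_of_mem_erase hi
          have hi' : i ≤ n := Nat.lt_succ_iff.1 (Finset.mem_range.1 (Finset.mem_of_mem_erase hi))
          have hpos : 0 < |(j : ℝ) - i| := abs_pos.2 (sub_ne_zero.2 (by exact_mod_cast hij.symm))
          have hti : ‖v i‖ ≤ s := by
            rw [hvdef]
            simpa using abs_le.2 (hEs (htE i hi'))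
          have h1 : ‖w - v i‖ ≤ 2 * s := (norm_sub_le _ _).trans (by linarith)
          simp only [Lagrange.basisDivisor, Polynomial.eval_mul, Polynomial.eval_C,
            Polynomial.eval_sub, Polynomial.eval_X, norm_mul, norm_inv, hvsub]
          calc |t j - t i|⁻¹ * ‖w - v i‖ ≤ (|(j : ℝ) - i| * (s / (n + 1)))⁻¹ * (2 * s) := by
                gcongr
                exact hdist i j hi' hj
            _ = _ := by field_simp
      _ = (2 * (n + 1)) ^ n * ((j.factorial : ℝ) * (n - j).factorial)⁻¹ := by
          rw [Finset.prod_mul_distrib, Finset.prod_const, hcard, Finset.prod_inv_distrib,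
            prod_erase_abs_sub n j hj]
      _ = _ := by
          rw [Nat.cast_choose ℝ hj, mul_pow]
          field_simp
  have hδ0 : 0 ≤ δ := (norm_nonneg _).trans (hδ _ (htE 0 (Nat.zero_le _)))
  have hexp : ((n : ℝ) + 1) ^ n / n.factorial ≤ 3 ^ (n + 1) := by
    calc ((n : ℝ) + 1) ^ n / n.factorial ≤ Real.exp (n + 1) :=
          Real.pow_div_factorial_le_exp _ hn.le n
      _ = Real.exp 1 ^ (n + 1) := by rw [← Real.exp_nat_mul]; push_cast; simp
      _ ≤ _ := by gcongr; exact Real.exp_one_lt_three.le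
  rw [Lagrange.eq_interpolate (f := p) hinj (by simpa using hp), Lagrange.interpolate_apply,
    Polynomial.eval_finsetSum]
  calc ‖∑ j ∈ Finset.range (n + 1), (Polynomial.C (p.eval (v j)) *
        Lagrange.basis (Finset.range (n + 1)) v j).eval w‖
      ≤ ∑ j ∈ Finset.range (n + 1), δ * ((2 ^ n * (n + 1) ^ n / n.factorial) * n.choose j) := by
        refine norm_sum_le_of_le _ fun j hj => ?_
        have hj' : j ≤ n := Nat.lt_succ_iff.1 (Finset.mem_range.1 hj)
        rw [Polynomial.eval_mul, Polynomial.eval_C, norm_mul]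
        exact mul_le_mul (hδ _ (htE j hj')) (hbasis j hj') (norm_nonneg _) hδ0
    _ = (2 ^ n * 2 ^ n * (((n : ℝ) + 1) ^ n / n.factorial)) * δ := by
        rw [← Finset.mul_sum, ← Finset.mul_sum, ← Nat.cast_sum, Nat.sum_range_choose]
        push_cast
        ring
    _ ≤ (2 ^ (n + 1) * 2 ^ (n + 1) * 3 ^ (n + 1)) * δ := by
        gcongr <;> norm_num
    _ = 12 ^ (n + 1) * δ := by rw [← mul_pow, ← mul_pow]; norm_num

theorem norm_le_of_norm_le_on_of_hasSum {s δ A : ℝ} (hs : 0 < s) {E : Set ℝ} (hE : IsCompact E)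
    (hEs : E ⊆ Set.Icc (-s) s) (hv : ENNReal.ofReal s ≤ MeasureTheory.volume E)
    {f : ℂ → ℂ} {c : ℕ → ℂ} (hc : ∀ l, ‖c l‖ * (24 * s) ^ l ≤ A)
    (hf : ∀ w, ‖w‖ ≤ s → HasSum (fun l => c l * w ^ l) (f w))
    (hδ : ∀ t ∈ E, ‖f (Complex.I * t)‖ ≤ δ) (n : ℕ) {w : ℂ} (hw : ‖w‖ ≤ s) :
    ‖f w‖ ≤ 12 ^ (n + 1) * δ + 4 * A / 2 ^ (n + 1) := by
  set p : Polynomial ℂ := ∑ l ∈ Finset.range (n + 1), Polynomial.C (c l) * Polynomial.X ^ l with hp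
  have hA : 0 ≤ A := (by positivity : 0 ≤ ‖c 0‖ * (24 * s) ^ 0).trans (hc 0)
  have hdeg : p.degree < (n + 1 : ℕ) := by
    refine (Polynomial.degree_sum_le _ _).trans_lt ?_
    rw [Finset.sup_lt_iff (WithBot.bot_lt_coe _)]
    intro l hl
    exact (Polynomial.degree_C_mul_X_pow_le l _).trans_lt
      (by exact_mod_cast Finset.mem_range.1 hl)
  have htail : ∀ w, ‖w‖ ≤ s → ‖f w - p.eval w‖ ≤ 2 * A / 24 ^ (n + 1) := by
    intro w hw
    have h1 := (hasSum_nat_add_iff' (n + 1)).2 (hf w hw)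
    have h2 : p.eval w = ∑ l ∈ Finset.range (n + 1), c l * w ^ l := by
      simp [hp, Polynomial.eval_finsetSum]
    rw [h2]
    refine (HasSum.norm_le_of_bounded h1 ((hasSum_geometric_of_lt_one (r := 1 / 24) (by norm_num)
      (by norm_num)).mul_left (A / 24 ^ (n + 1))) fun l => ?_).trans ?_
    · rw [norm_mul, norm_pow]
      calc ‖c (l + (n + 1))‖ * ‖w‖ ^ (l + (n + 1))
          ≤ ‖c (l + (n + 1))‖ * s ^ (l + (n + 1)) := by gcongr
        _ = ‖c (l + (n + 1))‖ * (24 * s) ^ (l + (n + 1)) / 24 ^ (l + (n + 1)) := by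
          rw [mul_pow]; field_simp
        _ ≤ A / 24 ^ (l + (n + 1)) := by gcongr; exact hc _
        _ = _ := by rw [pow_add, one_div, inv_pow]; field_simp
    · rw [mul_comm, mul_div_assoc]
      exact mul_le_mul_of_nonneg_right (by norm_num) (by positivity)
  have hpE : ∀ t ∈ E, ‖p.eval (Complex.I * t)‖ ≤ δ + 2 * A / 24 ^ (n + 1) := by
    intro t ht
    have h1 : ‖Complex.I * (t : ℂ)‖ ≤ s := by simpa using abs_le.2 (hEs ht)
    have h2 := norm_sub_le (f (Complex.I * t)) (f (Complex.I * t) - p.eval (Complex.I * t))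
    rw [sub_sub_cancel] at h2
    linarith [hδ t ht, htail _ h1]
  have h1 := norm_eval_le_of_norm_eval_le_on hs hE hEs hv hdeg hpE hw
  have h2 := norm_add_le (f w - p.eval w) (p.eval w)
  rw [sub_add_cancel] at h2
  have h3 : (2 * A / 24 ^ (n + 1) : ℝ) ≤ 2 * A / 2 ^ (n + 1) := by gcongr; norm_num
  have h4 : 12 ^ (n + 1) * (2 * A / 24 ^ (n + 1)) = 2 * A / 2 ^ (n + 1) := by
    rw [show (24 : ℝ) = 12 * 2 by norm_num, mul_pow]; field_simp
  have h5 : 4 * A / 2 ^ (n + 1) = 2 * A / 2 ^ (n + 1) + 2 * A / 2 ^ (n + 1) := by ring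
  rw [mul_add, h4] at h1
  linarith [htail w hw]

theorem differentiableOn_coeff_of_hasSum {S : Set ℂ} (hS : IsOpen S) {a : ℕ → ℂ → ℂ} {C r : ℝ}
    (hr : 0 < r) (ha : ∀ k, ∀ w ∈ S, ‖a k w‖ * r ^ k ≤ C) {g : ℂ → ℂ → ℂ}
    (hg : ∀ z, ‖z‖ < r → DifferentiableOn ℂ (g z) S)
    (hsum : ∀ z, ‖z‖ < r → ∀ w ∈ S, HasSum (fun k => a k w * z ^ k) (g z w)) (k : ℕ) :
    DifferentiableOn ℂ (a k) S := by
  induction k using Nat.strong_induction_on with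
  | _ k ih =>
  have hlt : ∀ ε > 0, ∀ᶠ h in nhdsWithin (0 : ℂ) {0}ᶜ, ‖h‖ < ε := fun ε hε =>
    Filter.Eventually.filter_mono nhdsWithin_le_nhds
      (by filter_upwards [Metric.ball_mem_nhds (0 : ℂ) hε] with h hh using mem_ball_zero_iff.1 hh)
  refine TendstoLocallyUniformlyOn.differentiableOn (φ := nhdsWithin (0 : ℂ) {0}ᶜ)
    (F := fun h w => (g h w - ∑ j ∈ Finset.range k, a j w * h ^ j) / h ^ k) ?_ ?_ hS
  · refine TendstoUniformlyOn.tendstoLocallyUniformlyOn ?_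
    rw [Metric.tendstoUniformlyOn_iff]
    intro ε hε
    have hD : 0 < 2 * |C| / r ^ (k + 1) + 1 := by positivity
    filter_upwards [hlt (r / 2) (by positivity), hlt (ε / (2 * |C| / r ^ (k + 1) + 1))
      (by positivity), self_mem_nhdsWithin] with h hh1 hh2 hh0 w hw
    have hh0' : h ≠ 0 := hh0
    have hhpos : 0 < ‖h‖ := norm_pos_iff.2 hh0'
    have hq : ‖h‖ / r ≤ 1 / 2 := by rw [div_le_iff₀ hr]; linarith
    have h1 := (hasSum_nat_add_iff' (k + 1)).2 (hsum h (by linarith) w hw)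
    have h2 : ‖g h w - ∑ j ∈ Finset.range (k + 1), a j w * h ^ j‖
        ≤ 2 * |C| * (‖h‖ / r) ^ (k + 1) := by
      refine (HasSum.norm_le_of_bounded h1 ((hasSum_geometric_of_lt_one (r := 1 / 2) (by norm_num)
        (by norm_num)).mul_left (|C| * (‖h‖ / r) ^ (k + 1))) fun l => ?_).trans
        (le_of_eq (by norm_num; ring))
      rw [norm_mul, norm_pow]
      calc ‖a (l + (k + 1)) w‖ * ‖h‖ ^ (l + (k + 1))
          = (‖a (l + (k + 1)) w‖ * r ^ (l + (k + 1))) * (‖h‖ / r) ^ (l + (k + 1)) := by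
            rw [div_pow]; field_simp
        _ ≤ |C| * (‖h‖ / r) ^ (l + (k + 1)) := by
            gcongr
            exact (ha _ w hw).trans (le_abs_self C)
        _ = |C| * (‖h‖ / r) ^ (k + 1) * (‖h‖ / r) ^ l := by ring
        _ ≤ _ := by gcongr
    have h3 : a k w - (g h w - ∑ j ∈ Finset.range k, a j w * h ^ j) / h ^ k
        = -((g h w - ∑ j ∈ Finset.range (k + 1), a j w * h ^ j) / h ^ k) := by
      rw [Finset.sum_range_succ]
      field_simp
      ring
    rw [dist_eq_norm, h3, norm_neg, norm_div, norm_pow]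
    calc _ ≤ 2 * |C| * (‖h‖ / r) ^ (k + 1) / ‖h‖ ^ k := by gcongr
      _ = 2 * |C| / r ^ (k + 1) * ‖h‖ := by rw [div_pow]; field_simp; ring
      _ ≤ (2 * |C| / r ^ (k + 1) + 1) * ‖h‖ := by gcongr; linarith
      _ < ε := by rwa [mul_comm, ← lt_div_iff₀ hD]
  · filter_upwards [hlt r hr] with h hh
    refine DifferentiableOn.div_const ((hg h hh).sub ?_) _
    exact DifferentiableOn.fun_sum fun j hj =>
      (ih j (Finset.mem_range.1 hj)).mul_const _

theorem differentiableOn_tsum_mul_pow {s : ℝ} {a : ℕ → ℂ → ℂ}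
    (ha : ∀ k, DifferentiableOn ℂ (a k) (Metric.ball 0 s))
    (hgrowth : ∀ R > 0, ∃ B, ∀ k, ∀ w ∈ Metric.ball (0 : ℂ) s, ‖a k w‖ * R ^ k ≤ B) :
    DifferentiableOn ℂ (fun p : ℂ × ℂ => ∑' k, a k p.2 * p.1 ^ k)
      (Set.univ ×ˢ Metric.ball 0 (s / 2)) := by
  rintro p ⟨-, hp⟩
  have hs : 0 < s := by
    have := Metric.pos_of_mem_ball hp
    linarith
  refine DifferentiableAt.differentiableWithinAt ?_
  set R : ℝ := ‖p.1‖ + 1 with hR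
  have hR1 : 1 ≤ R := by simp [hR]
  have hR0 : 0 < R := by linarith
  obtain ⟨B, hB⟩ := hgrowth (2 * R) (by positivity)
  have haB : ∀ k, ∀ w ∈ Metric.ball (0 : ℂ) s, ‖a k w‖ ≤ B / (2 * R) ^ k := fun k w hw => by
    rw [le_div_iff₀ (by positivity)]; exact hB k w hw
  have hB0 : 0 ≤ B := (by positivity : 0 ≤ ‖a 0 0‖ * (2 * R) ^ 0).trans
    (hB 0 0 (Metric.mem_ball_self hs))
  have hmem : ∀ w ∈ Metric.ball (0 : ℂ) (s / 2), w ∈ Metric.ball (0 : ℂ) s := fun w hw =>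
    Metric.ball_subset_ball (by linarith) hw
  have hderiv : ∀ k, ∀ w ∈ Metric.ball (0 : ℂ) (s / 2),
      ‖deriv (a k) w‖ ≤ B / (2 * R) ^ k / (s / 4) := by
    intro k w hw
    have hsub : Metric.closedBall w (s / 4) ⊆ Metric.ball 0 s := by
      intro x hx
      rw [Metric.mem_closedBall] at hx
      rw [Metric.mem_ball] at hw ⊢
      linarith [dist_triangle x w 0]
    refine Complex.norm_deriv_le_of_forall_mem_sphere_norm_le (by positivity)
      (((ha k).mono hsub).diffContOnCl_ball le_rfl) fun z hz => ?_
    exact haB k z (hsub (Metric.sphere_subset_closedBall hz))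
  have hu : Summable fun k : ℕ => B * ((k : ℝ) ^ 1 * (1 / 2) ^ k) + B * (4 / s) * (1 / 2) ^ k :=
    ((summable_pow_mul_geometric_of_norm_lt_one 1 (by norm_num)).mul_left B).add
      ((summable_geometric_of_lt_one (by norm_num) (by norm_num)).mul_left _)
  have hopen : IsOpen (Metric.ball (0 : ℂ) R ×ˢ Metric.ball (0 : ℂ) (s / 2)) :=
    Metric.isOpen_ball.prod Metric.isOpen_ball
  refine (hasFDerivAt_tsum_of_isPreconnected (𝕜 := ℂ) (x₀ := (0, 0))
    (f' := fun k (q : ℂ × ℂ) => a k q.2 • (k * q.1 ^ (k - 1)) • ContinuousLinearMap.fst ℂ ℂ ℂ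
      + q.1 ^ k • deriv (a k) q.2 • ContinuousLinearMap.snd ℂ ℂ ℂ) hu hopen
    ((convex_ball _ _).prod (convex_ball _ _)).isPreconnected ?_ ?_ ?_ ?_ ?_).differentiableAt
  · rintro k ⟨z, w⟩ ⟨hz, hw⟩
    have h1 : HasFDerivAt (fun q : ℂ × ℂ => a k q.2) _ (z, w) :=
      (((ha k).differentiableAt (Metric.isOpen_ball.mem_nhds (hmem w hw))).hasDerivAt
        |>.comp_hasFDerivAt (z, w) (hasFDerivAt_snd (𝕜 := ℂ) (p := (z, w))))
    have h2 : HasFDerivAt (fun q : ℂ × ℂ => q.1 ^ k) _ (z, w) :=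
      ((hasDerivAt_pow k z).comp_hasFDerivAt (z, w) (hasFDerivAt_fst (𝕜 := ℂ) (p := (z, w))))
    exact h1.mul h2
  · rintro k ⟨z, w⟩ ⟨hz, hw⟩
    have hz' : ‖z‖ ≤ R := (mem_ball_zero_iff.1 hz).le
    have hpow : ‖z‖ ^ (k - 1) ≤ R ^ k :=
      (pow_le_pow_left₀ (norm_nonneg _) hz' _).trans (pow_le_pow_right₀ hR1 (Nat.sub_le _ _))
    have hB2 : B / (2 * R) ^ k * R ^ k = B * (1 / 2) ^ k := by
      rw [mul_pow, one_div, inv_pow]; field_simp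
    refine (norm_add_le _ _).trans (add_le_add ?_ ?_)
    · rw [norm_smul, norm_smul, norm_mul, norm_pow, Complex.norm_natCast]
      calc ‖a k w‖ * (k * ‖z‖ ^ (k - 1) * ‖ContinuousLinearMap.fst ℂ ℂ ℂ‖)
          ≤ B / (2 * R) ^ k * (k * R ^ k * 1) := by
            gcongr
            · exact haB k w (hmem w hw)
            · exact ContinuousLinearMap.norm_fst_le ℂ ℂ ℂ
        _ = k * (B / (2 * R) ^ k * R ^ k) := by ring
        _ = _ := by rw [hB2]; ring
    · rw [norm_smul, norm_smul, norm_pow]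
      calc ‖z‖ ^ k * (‖deriv (a k) w‖ * ‖ContinuousLinearMap.snd ℂ ℂ ℂ‖)
          ≤ R ^ k * (B / (2 * R) ^ k / (s / 4) * 1) := by
            gcongr
            · exact hderiv k w hw
            · exact ContinuousLinearMap.norm_snd_le ℂ ℂ ℂ
        _ = (B / (2 * R) ^ k * R ^ k) * (4 / s) := by field_simp
        _ = _ := by rw [hB2]; ring
  · exact ⟨Metric.mem_ball_self hR0, Metric.mem_ball_self (by positivity)⟩
  · refine summable_of_ne_finset_zero (s := {0}) fun k hk => ?_
    simp [Finset.mem_singleton.not.1 hk]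
  · exact ⟨by simp [hR], hp⟩

theorem exists_norm_mul_pow_le_of_tendsto_zero {s C : ℝ} (hs : 0 < s) {a : ℕ → ℂ → ℂ}
    (hd : ∀ k, DifferentiableOn ℂ (a k) (Metric.ball 0 (48 * s)))
    (hC : ∀ k, ∀ w ∈ Metric.ball (0 : ℂ) (48 * s), ‖a k w‖ * (48 * s) ^ k ≤ C)
    (hlim : ∀ t ∈ Set.Icc (-s) s, ∀ M > 0,
      ∀ᶠ k in Filter.atTop, ‖a k (Complex.I * (t : ℝ))‖ * M ^ k ≤ 1)
    {R : ℝ} (hR : 0 < R) : ∃ B, ∀ k, ∀ w ∈ Metric.ball (0 : ℂ) s, ‖a k w‖ * R ^ k ≤ B := by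
  set ρ : ℝ := 48 * s with hρ
  have hρ0 : 0 < ρ := by positivity
  have hC0 : 0 ≤ C := (by positivity : 0 ≤ ‖a 0 0‖ * ρ ^ 0).trans
    (hC 0 0 (Metric.mem_ball_self hρ0))
  have haC : ∀ k, ∀ w ∈ Metric.ball (0 : ℂ) ρ, ‖a k w‖ ≤ C / ρ ^ k := fun k w hw => by
    rw [le_div_iff₀ (by positivity)]; exact hC k w hw
  obtain ⟨m, hm⟩ := pow_unbounded_of_one_lt (R / ρ) one_lt_two
  have hm1 : R / ρ ≤ 2 ^ (m + 1) := hm.le.trans (pow_le_pow_right₀ one_le_two (Nat.le_succ m))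
  set M : ℝ := 12 ^ (m + 1) * R with hM
  have hM0 : 0 < M := by positivity
  have hI : ∀ t ∈ Set.Icc (-s) s, Complex.I * (t : ℂ) ∈ Metric.ball (0 : ℂ) ρ := by
    intro t ht
    have : |t| ≤ s := abs_le.2 ht
    rw [mem_ball_zero_iff]
    simp only [norm_mul, Complex.norm_I, one_mul, Complex.norm_real, Real.norm_eq_abs]
    linarith
  let E : ℕ → Set ℝ := fun N =>
    {t ∈ Set.Icc (-s) s | ∀ k ≥ N, ‖a k (Complex.I * (t : ℂ))‖ * M ^ k ≤ 1}
  have hEmono : Monotone E := fun N N' h t ht => ⟨ht.1, fun k hk => ht.2 k (h.trans hk)⟩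
  have hEunion : ⋃ N, E N = Set.Icc (-s) s := by
    refine Set.Subset.antisymm (Set.iUnion_subset fun N t ht => ht.1) fun t ht => ?_
    obtain ⟨N, hN⟩ := Filter.eventually_atTop.1 (hlim t ht M hM0)
    exact Set.mem_iUnion.2 ⟨N, ht, hN⟩
  have hEcompact : ∀ N, IsCompact (E N) := by
    intro N
    have h1 : E N = ⋂ k ≥ N, {t ∈ Set.Icc (-s) s | ‖a k (Complex.I * (t : ℂ))‖ * M ^ k ≤ 1}
        ∩ Set.Icc (-s) s := by
      ext t
      simp only [E, Set.mem_ofPred_eq, Set.mem_iInter, Set.mem_inter_iff]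
      exact ⟨fun h k hk => ⟨⟨h.1, h.2 k hk⟩, h.1⟩,
        fun h => ⟨(h N le_rfl).2, fun k hk => (h k hk).1.2⟩⟩
    refine isCompact_Icc.of_isClosed_subset ?_ (fun t ht => ht.1 : E N ⊆ Set.Icc (-s) s)
    rw [h1]
    refine isClosed_biInter fun k _ => IsClosed.inter ?_ isClosed_Icc
    refine ContinuousOn.preimage_isClosed_of_isClosed
      (f := fun t : ℝ => ‖a k (Complex.I * (t : ℂ))‖ * M ^ k) ?_ isClosed_Icc
      (isClosed_Iic (a := (1 : ℝ)))
    refine ContinuousOn.mul (ContinuousOn.norm ?_) continuousOn_const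
    exact (hd k).continuousOn.comp (by fun_prop) hI
  obtain ⟨N, hN⟩ : ∃ N, ENNReal.ofReal s < MeasureTheory.volume (E N) := by
    have h1 := MeasureTheory.tendsto_measure_iUnion_atTop (μ := MeasureTheory.volume) hEmono
    rw [hEunion, Real.volume_Icc] at h1
    exact (h1.eventually_const_lt
      ((ENNReal.ofReal_lt_ofReal_iff (by linarith)).2 (by linarith))).exists
  have hlarge : ∀ k, N ≤ k → 1 ≤ k → ∀ w ∈ Metric.ball (0 : ℂ) s,
      ‖a k w‖ * R ^ k ≤ 1 + 4 * C := by
    intro k hNk hk w hw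
    obtain ⟨n, hn⟩ : ∃ n, (m + 1) * k = n + 1 :=
      Nat.exists_eq_add_one_of_ne_zero (Nat.mul_ne_zero (by omega) (by omega))
    have hsub : Metric.closedBall (0 : ℂ) (24 * s) ⊆ Metric.ball 0 ρ :=
      Metric.closedBall_subset_ball (by linarith)
    have h1 := norm_le_of_norm_le_on_of_hasSum (f := a k) (δ := 1 / M ^ k) (A := C / ρ ^ k)
      (c := fun l => (l.factorial : ℂ)⁻¹ * iteratedDeriv l (a k) 0) hs (hEcompact N)
      (fun t ht => ht.1) hN.le ?_ ?_ ?_ n (mem_ball_zero_iff.1 hw).le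
    · rw [← hn, pow_mul, pow_mul] at h1
      calc ‖a k w‖ * R ^ k
          ≤ ((12 ^ (m + 1)) ^ k * (1 / M ^ k) + 4 * (C / ρ ^ k) / (2 ^ (m + 1)) ^ k) * R ^ k := by
            gcongr
        _ = 1 + 4 * C * ((R / ρ) ^ k / (2 ^ (m + 1)) ^ k) := by
            rw [hM, mul_pow, div_pow]; field_simp
        _ ≤ 1 + 4 * C * 1 := by
            gcongr
            exact div_le_one_of_le₀ (pow_le_pow_left₀ (by positivity) hm1 k) (by positivity)
        _ = _ := by ring
    · intro l
      have h2 := Complex.norm_iteratedDeriv_le_of_forall_mem_sphere_norm_le l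
        (by positivity : 0 < 24 * s) (((hd k).mono hsub).diffContOnCl_ball le_rfl)
        fun z hz => haC k z (hsub (Metric.sphere_subset_closedBall hz))
      rw [norm_mul, norm_inv, Complex.norm_natCast]
      calc _ ≤ (l.factorial : ℝ)⁻¹ * (l.factorial * (C / ρ ^ k) / (24 * s) ^ l) * (24 * s) ^ l := by
            gcongr
        _ = _ := by
          have := Nat.factorial_pos l
          field_simp
    · intro w hw
      have h2 := Complex.hasSum_taylorSeries_on_ball (hd k)
        (mem_ball_zero_iff.2 (by linarith) : w ∈ Metric.ball 0 ρ)
      refine h2.congr_fun fun l => ?_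
      simp only [sub_zero, smul_eq_mul]
      ring
    · intro t ht
      rw [le_div_iff₀ (by positivity)]
      exact ht.2 k hNk
  refine ⟨1 + 4 * C + ∑ k ∈ Finset.range (N + 1), C / ρ ^ k * R ^ k, fun k w hw => ?_⟩
  by_cases hk : k < N + 1
  · have h1 : ‖a k w‖ * R ^ k ≤ C / ρ ^ k * R ^ k := by
      gcongr
      exact haC k w (Metric.ball_subset_ball (by linarith) hw)
    have h2 := Finset.single_le_sum (f := fun k => C / ρ ^ k * R ^ k)
      (fun i _ => by positivity) (Finset.mem_range.2 hk)
    linarith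
  · have h1 : 0 ≤ ∑ k ∈ Finset.range (N + 1), C / ρ ^ k * R ^ k :=
      Finset.sum_nonneg fun i _ => by positivity
    linarith [hlarge k (by omega) (by omega) w hw]

theorem propagation_along_complex_curve_flat_model
    (F : ℂ × ℂ → ℂ)
    (hsep : ∀ t : ℝ, Differentiable ℂ (fun z₁ : ℂ => F (z₁, Complex.I * (t : ℂ))))
    (hloc : ∃ (V : Set (ℂ × ℂ)) (G : ℂ × ℂ → ℂ), IsOpen V ∧ ((0 : ℂ), (0 : ℂ)) ∈ V ∧
      DifferentiableOn ℂ G V ∧ ∀ p ∈ V, p.2.re = 0 → G p = F p) :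
    ∃ (U : Set (ℂ × ℂ)) (H : ℂ × ℂ → ℂ), IsOpen U ∧ (∀ z₁ : ℂ, (z₁, (0 : ℂ)) ∈ U) ∧
      DifferentiableOn ℂ H U ∧ ∀ p ∈ U, p.2.re = 0 → H p = F p := by
  obtain ⟨V, G, hV, h0V, hG, hGF⟩ := hloc
  obtain ⟨r, hr, hrV⟩ := Metric.nhds_basis_closedBall.mem_iff.1 (hV.mem_nhds h0V)
  obtain ⟨s, hs, rfl⟩ : ∃ s, 0 < s ∧ r = 48 * s := ⟨r / 48, by positivity, by ring⟩
  obtain ⟨C, hC⟩ := (isCompact_closedBall ((0 : ℂ), (0 : ℂ)) (48 * s)).exists_bound_of_continuousOn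
    (hG.continuousOn.mono hrV)
  have hmem : ∀ z w : ℂ, ‖z‖ ≤ 48 * s → ‖w‖ ≤ 48 * s →
      (z, w) ∈ Metric.closedBall ((0 : ℂ), (0 : ℂ)) (48 * s) := by
    intro z w hz hw
    rw [← closedBall_prod_same]
    exact ⟨by simpa using hz, by simpa using hw⟩
  have hGat : ∀ z w : ℂ, ‖z‖ ≤ 48 * s → ‖w‖ ≤ 48 * s → DifferentiableAt ℂ G (z, w) :=
    fun z w hz hw => hG.differentiableAt (hV.mem_nhds (hrV (hmem z w hz hw)))
  have hG1 : ∀ w : ℂ, ‖w‖ ≤ 48 * s →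
      DifferentiableOn ℂ (fun z => G (z, w)) (Metric.closedBall 0 (48 * s)) := fun w hw z hz =>
    (DifferentiableAt.fun_comp' z (hGat z w (by simpa using hz) hw)
      (by fun_prop)).differentiableWithinAt
  have hG2 : ∀ z : ℂ, ‖z‖ < 48 * s →
      DifferentiableOn ℂ (fun w => G (z, w)) (Metric.ball 0 (48 * s)) := fun z hz w hw =>
    (DifferentiableAt.fun_comp' w (hGat z w hz.le (mem_ball_zero_iff.1 hw).le)
      (by fun_prop)).differentiableWithinAt
  let a : ℕ → ℂ → ℂ := fun k w => (k.factorial : ℂ)⁻¹ * iteratedDeriv k (fun z => G (z, w)) 0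
  have haC : ∀ k, ∀ w ∈ Metric.ball (0 : ℂ) (48 * s), ‖a k w‖ * (48 * s) ^ k ≤ C := by
    intro k w hw
    have hw' : ‖w‖ ≤ 48 * s := (mem_ball_zero_iff.1 hw).le
    have h2 := Complex.norm_iteratedDeriv_le_of_forall_mem_sphere_norm_le k hr
      ((hG1 w hw').diffContOnCl_ball le_rfl)
      fun z hz => hC _ (hmem z w (mem_sphere_zero_iff_norm.1 hz).le hw')
    simp only [a]
    rw [norm_mul, norm_inv, Complex.norm_natCast]
    calc _ ≤ (k.factorial : ℝ)⁻¹ * (k.factorial * C / (48 * s) ^ k) * (48 * s) ^ k := by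
          gcongr
      _ = _ := by
        have := Nat.factorial_pos k
        field_simp
  have hsum : ∀ z, ‖z‖ < 48 * s → ∀ w ∈ Metric.ball (0 : ℂ) (48 * s),
      HasSum (fun k => a k w * z ^ k) (G (z, w)) := by
    intro z hz w hw
    refine (Complex.hasSum_taylorSeries_on_ball ((hG1 w (mem_ball_zero_iff.1 hw).le).mono
      Metric.ball_subset_closedBall) (mem_ball_zero_iff.2 hz)).congr_fun fun k => ?_
    simp only [a, sub_zero, smul_eq_mul]
    ring
  have had := differentiableOn_coeff_of_hasSum (g := fun z w => G (z, w)) Metric.isOpen_ball hr haC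
    hG2 hsum
  have hF : ∀ t : ℝ, |t| ≤ s → ∀ z, HasSum (fun k => a k (Complex.I * t) * z ^ k)
      (F (z, Complex.I * t)) := by
    intro t ht z
    have heq : (fun z => G (z, Complex.I * t)) =ᶠ[nhds 0] fun z => F (z, Complex.I * t) := by
      filter_upwards [Metric.closedBall_mem_nhds (0 : ℂ) hr] with z hz
      refine hGF _ (hrV (hmem _ _ (by simpa using hz) ?_)) (by simp)
      simp only [norm_mul, Complex.norm_I, one_mul, Complex.norm_real, Real.norm_eq_abs]
      linarith
    refine (Complex.hasSum_taylorSeries_of_entire (hsep t) 0 z).congr_fun fun k => ?_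
    simp only [a, sub_zero, smul_eq_mul, heq.iteratedDeriv_eq k]
    ring
  have hlim : ∀ t ∈ Set.Icc (-s) s, ∀ M > 0,
      ∀ᶠ k in Filter.atTop, ‖a k (Complex.I * (t : ℝ))‖ * M ^ k ≤ 1 := by
    intro t ht M hM
    filter_upwards [(tendsto_zero_iff_norm_tendsto_zero.1
      (hF t (abs_le.2 ht) M).summable.tendsto_atTop_zero).eventually_le_const zero_lt_one] with k hk
    simpa [abs_of_pos hM] using hk
  refine ⟨Set.univ ×ˢ Metric.ball 0 (s / 2), fun p => ∑' k, a k p.2 * p.1 ^ k,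
    isOpen_univ.prod Metric.isOpen_ball, fun z => ⟨trivial, Metric.mem_ball_self (by positivity)⟩,
    differentiableOn_tsum_mul_pow
      (fun k => (had k).mono (Metric.ball_subset_ball (by linarith)))
      fun R hR => exists_norm_mul_pow_le_of_tendsto_zero hs had haC hlim hR, ?_⟩
  rintro ⟨z, w⟩ ⟨-, hw⟩ hre
  obtain ⟨t, rfl⟩ : ∃ t : ℝ, w = Complex.I * t := ⟨w.im, by
    apply Complex.ext <;> simp_all⟩
  refine (hF t ?_ z).tsum_eq
  have h1 : |t| < s / 2 := by simpa using hw
  linarith
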